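/- arXiv:2507.21906 — 4 statements merged into one kernel-verified Lean document; each statement's English description precedes it below -/
import Mathlib

section
/- Let n be a natural number, g an invertible real n×n matrix, A a real column vector of length n, and t a nonzero real number. Define G = fromBlocks (g − A·Aᵀ) (−t⁻¹·A) (−t⁻¹·Aᵀ) (−t⁻²) and H = fromBlocks g⁻¹ (−t·g⁻¹·A) (−t·Aᵀ·g⁻¹) (−t² + t²·Aᵀ·g⁻¹·A). Then G·H = 1 and H·G = 1, i.e. H = G⁻¹. -/
open Matrix

/-- The paper's block formula for the inverse of the canonical Lorentzian metric
`G = g − θ⊗θ` on a Carrollian `ℝ^×`-bundle: with `H` given by the stated blocks,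
`G * H = 1` and `H * G = 1`, i.e. `H = G⁻¹`. -/
theorem carroll_metric_inverse
    (n : ℕ) (g : Matrix (Fin n) (Fin n) ℝ) (hg : IsUnit g)
    (A : Matrix (Fin n) (Fin 1) ℝ) (t : ℝ) (ht : t ≠ 0) :
    fromBlocks (g - A * Aᵀ) (-t⁻¹ • A) (-t⁻¹ • Aᵀ)
        (-(t ^ 2)⁻¹ • (1 : Matrix (Fin 1) (Fin 1) ℝ)) *
      fromBlocks g⁻¹ (-t • (g⁻¹ * A)) (-t • (Aᵀ * g⁻¹))
        (-(t ^ 2) • (1 : Matrix (Fin 1) (Fin 1) ℝ) + (t ^ 2) • (Aᵀ * g⁻¹ * A)) = 1 ∧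
    fromBlocks g⁻¹ (-t • (g⁻¹ * A)) (-t • (Aᵀ * g⁻¹))
        (-(t ^ 2) • (1 : Matrix (Fin 1) (Fin 1) ℝ) + (t ^ 2) • (Aᵀ * g⁻¹ * A)) *
      fromBlocks (g - A * Aᵀ) (-t⁻¹ • A) (-t⁻¹ • Aᵀ)
        (-(t ^ 2)⁻¹ • (1 : Matrix (Fin 1) (Fin 1) ℝ)) = 1 := by
  have hdet : IsUnit g.det := (Matrix.isUnit_iff_isUnit_det g).mp hg
  have hgg : g * g⁻¹ = 1 := Matrix.mul_nonsing_inv g hdet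
  have hgA : g * (g⁻¹ * A) = A := by rw [← Matrix.mul_assoc, hgg, Matrix.one_mul]
  rw [and_iff_left_of_imp mul_eq_one_comm.mp, fromBlocks_multiply, ← fromBlocks_one]
  congr 1 <;>
    simp only [Matrix.sub_mul, Matrix.mul_add, Matrix.smul_mul, Matrix.mul_smul, Matrix.mul_one,
      Matrix.one_mul, Matrix.mul_assoc, hgg, hgA]
  all_goals
    match_scalars <;> field_simp <;> ring
end

section
/- Let n be a natural number, g a positive-definite symmetric real n×n matrix, A a real column vector of length n, and t a nonzero real number. Then there exists an invertible real (n+1)×(n+1) matrix P such that Pᵀ · G · P = diag(1, …, 1, −1), where G = fromBlocks (g − A·Aᵀ) (−t⁻¹·A) (−t⁻¹·Aᵀ) (−t⁻²). That is, the canonical metric G = g − θ⊗θ on a Carrollian ℝ×-bundle has Lorentzian signature (1, …, 1, −1). -/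
open Matrix

/-- A positive definite real matrix is congruent to the identity. -/
theorem Matrix.PosDef.exists_isUnit_transpose_mul_mul_eq_one {m : Type*} [Fintype m]
    [DecidableEq m] {g : Matrix m m ℝ} (hg : g.PosDef) :
    ∃ C : Matrix m m ℝ, IsUnit C ∧ Cᵀ * g * C = 1 := by
  open scoped MatrixOrder in
  obtain ⟨B, hB, rfl⟩ := CStarAlgebra.isStrictlyPositive_iff_eq_star_mul_self.mp
    hg.isStrictlyPositive
  have hdet := (isUnit_iff_isUnit_det B).mp hB
  refine ⟨B⁻¹, isUnit_nonsing_inv_iff.mpr hB, ?_⟩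
  rw [star_eq_conjTranspose, conjTranspose_eq_transpose_of_trivial, ← Matrix.mul_assoc,
    ← transpose_mul, mul_nonsing_inv _ hdet, transpose_one, Matrix.one_mul,
    mul_nonsing_inv _ hdet]

/-- The canonical metric `G = g − θ⊗θ` on a Carrollian `ℝ^×`-bundle has Lorentzian
signature `(1, …, 1, −1)`: for `g` positive-definite symmetric there is an invertible
matrix `P` with `Pᵀ * G * P = diag(1, …, 1, −1)`. -/
theorem carroll_metric_lorentzian_signature
    (n : ℕ) (g : Matrix (Fin n) (Fin n) ℝ) (hg : g.PosDef)
    (A : Matrix (Fin n) (Fin 1) ℝ) (t : ℝ) (ht : t ≠ 0) :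
    ∃ P : Matrix (Fin n ⊕ Fin 1) (Fin n ⊕ Fin 1) ℝ, IsUnit P ∧
      Pᵀ *
        fromBlocks (g - A * Aᵀ) (-t⁻¹ • A) (-t⁻¹ • Aᵀ)
          (-(t ^ 2)⁻¹ • (1 : Matrix (Fin 1) (Fin 1) ℝ)) *
        P =
      fromBlocks (1 : Matrix (Fin n) (Fin n) ℝ) (0 : Matrix (Fin n) (Fin 1) ℝ)
        (0 : Matrix (Fin 1) (Fin n) ℝ) (-(1 : Matrix (Fin 1) (Fin 1) ℝ)) := by
  obtain ⟨C, hC, hgC⟩ := hg.exists_isUnit_transpose_mul_mul_eq_one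
  refine ⟨fromBlocks C 0 (-t • (Aᵀ * C)) (t • (1 : Matrix (Fin 1) (Fin 1) ℝ)), ?_, ?_⟩
  · rw [isUnit_iff_isUnit_det, det_fromBlocks_zero₁₂]
    exact ((isUnit_iff_isUnit_det C).mp hC).mul (by simpa using ht)
  · rw [fromBlocks_transpose, fromBlocks_multiply, fromBlocks_multiply, ← hgC]
    congr 1
    all_goals
      simp [Matrix.mul_sub, smul_smul, ht,
        Matrix.mul_assoc, pow_two]
end

section
/- Let E, B : ℝ × ℝ³ → ℝ³ be smooth on the set t > 0, and define Ẽ, B̃ : ℝ × ℝ³ → ℝ³ by Ẽ(u,x) := E(e^u, x) and B̃(u,x) := B(e^u, x). Then E and B satisfy the Carrollian Maxwell equations (∇·B = 0, ∇·E = 0, ∇×E = t∂_t B, ∇×B = −t∂_t E) for all t > 0 if and only if Ẽ and B̃ satisfy the standard vacuum Maxwell equations in the time variable u: ∇·B̃ = 0, ∇·Ẽ = 0, ∇×Ẽ = ∂_u B̃, ∇×B̃ = −∂_u Ẽ, for all u ∈ ℝ. -/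
/-- A time-dependent vector field on `ℝ³`. -/
abbrev VField := ℝ × (Fin 3 → ℝ) → Fin 3 → ℝ

/-- Partial derivative of a scalar function on `ℝ × ℝ³` in the spatial direction `j`. -/
noncomputable def pdS (j : Fin 3) (f : ℝ × (Fin 3 → ℝ) → ℝ) : ℝ × (Fin 3 → ℝ) → ℝ :=
  fun p => deriv (fun s => f (p.1, Function.update p.2 j s)) (p.2 j)

/-- Partial derivative of a scalar function on `ℝ × ℝ³` in the time direction. -/
noncomputable def pdT (f : ℝ × (Fin 3 → ℝ) → ℝ) : ℝ × (Fin 3 → ℝ) → ℝ :=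
  fun p => deriv (fun s => f (s, p.2)) p.1

/-- Spatial divergence `∇·F` of a time-dependent vector field on `ℝ³`. -/
noncomputable def divg (F : VField) : ℝ × (Fin 3 → ℝ) → ℝ :=
  fun p => ∑ j : Fin 3, pdS j (fun q => F q j) p

/-- Spatial curl `∇×F` of a time-dependent vector field on `ℝ³`. -/
noncomputable def curl (F : VField) : VField :=
  fun p => ![pdS 1 (fun q => F q 2) p - pdS 2 (fun q => F q 1) p,
             pdS 2 (fun q => F q 0) p - pdS 0 (fun q => F q 2) p,
             pdS 0 (fun q => F q 1) p - pdS 1 (fun q => F q 0) p]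

/-- The vacuum Carrollian Maxwell equations at a point `p = (t, x)`:
`∇·B = 0`, `∇·E = 0`, `∇×E = t ∂_t B` and `∇×B = −t ∂_t E`. -/
def IsCarrollMaxwellAt (E B : VField) (p : ℝ × (Fin 3 → ℝ)) : Prop :=
  divg B p = 0 ∧ divg E p = 0 ∧
  (∀ i : Fin 3, curl E p i = p.1 * pdT (fun q => B q i) p) ∧
  (∀ i : Fin 3, curl B p i = -(p.1 * pdT (fun q => E q i) p))

/-- The standard vacuum Maxwell equations at a point `p = (u, x)`:
`∇·B = 0`, `∇·E = 0`, `∇×E = ∂_u B` and `∇×B = −∂_u E`. -/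
def IsMaxwellAt (E B : VField) (p : ℝ × (Fin 3 → ℝ)) : Prop :=
  divg B p = 0 ∧ divg E p = 0 ∧
  (∀ i : Fin 3, curl E p i = pdT (fun q => B q i) p) ∧
  (∀ i : Fin 3, curl B p i = -(pdT (fun q => E q i) p))

/-- Chain rule for the time derivative under the substitution `t = exp u`. -/
theorem pdT_comp_exp {f : ℝ × (Fin 3 → ℝ) → ℝ} {p : ℝ × (Fin 3 → ℝ)}
    (hf : DifferentiableAt ℝ f (Real.exp p.1, p.2)) :
    pdT (fun q => f (Real.exp q.1, q.2)) p =
      Real.exp p.1 * pdT f (Real.exp p.1, p.2) := by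
  have hg : DifferentiableAt ℝ (fun s => f (s, p.2)) (Real.exp p.1) :=
    DifferentiableAt.comp (f := fun s : ℝ => (s, p.2)) (Real.exp p.1) hf (by fun_prop)
  have h := (hg.hasDerivAt.comp p.1 (Real.hasDerivAt_exp p.1)).deriv
  rw [mul_comm]
  exact h

theorem differentiableAt_component_of_contDiffOn {F : VField}
    (hF : ContDiffOn ℝ (⊤ : ℕ∞) F {p : ℝ × (Fin 3 → ℝ) | 0 < p.1})
    {p : ℝ × (Fin 3 → ℝ)} (hp : 0 < p.1) (i : Fin 3) :
    DifferentiableAt ℝ (fun q => F q i) p := by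
  have hopen : IsOpen {p : ℝ × (Fin 3 → ℝ) | 0 < p.1} :=
    isOpen_lt continuous_const continuous_fst
  have h : DifferentiableAt ℝ F p :=
    (hF.contDiffAt (hopen.mem_nhds hp)).differentiableAt (by simp)
  exact differentiableAt_pi.1 h i

/-- The Carrollian equations at `(exp u, x)` are the standard Maxwell equations at `(u, x)` for
the fields in logarithmic time. -/
theorem isMaxwellAt_comp_exp_iff {E B : VField} {p : ℝ × (Fin 3 → ℝ)}
    (hE : ∀ i, DifferentiableAt ℝ (fun q => E q i) (Real.exp p.1, p.2))
    (hB : ∀ i, DifferentiableAt ℝ (fun q => B q i) (Real.exp p.1, p.2)) :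
    IsMaxwellAt (fun q => E (Real.exp q.1, q.2)) (fun q => B (Real.exp q.1, q.2)) p ↔
      IsCarrollMaxwellAt E B (Real.exp p.1, p.2) := by
  unfold IsMaxwellAt IsCarrollMaxwellAt
  simp only [fun i => pdT_comp_exp (hE i), fun i => pdT_comp_exp (hB i)]
  rfl

/-- In logarithmic time `u = ln t` (i.e. `t = e^u`), the Carrollian Maxwell equations
for `(E, B)` on `t > 0` are equivalent to the standard vacuum Maxwell equations for
`Ẽ(u,x) := E(e^u, x)`, `B̃(u,x) := B(e^u, x)` for all `u ∈ ℝ`. -/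
theorem carrollMaxwell_iff_maxwell_logTime (E B : VField)
    (hE : ContDiffOn ℝ (⊤ : ℕ∞) E {p : ℝ × (Fin 3 → ℝ) | 0 < p.1})
    (hB : ContDiffOn ℝ (⊤ : ℕ∞) B {p : ℝ × (Fin 3 → ℝ) | 0 < p.1}) :
    (∀ p : ℝ × (Fin 3 → ℝ), 0 < p.1 → IsCarrollMaxwellAt E B p) ↔
    (∀ p : ℝ × (Fin 3 → ℝ),
      IsMaxwellAt (fun q => E (Real.exp q.1, q.2)) (fun q => B (Real.exp q.1, q.2)) p) := by
  have key (p : ℝ × (Fin 3 → ℝ)) := isMaxwellAt_comp_exp_iff (E := E) (B := B) (p := p)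
    (differentiableAt_component_of_contDiffOn hE (Real.exp_pos _))
    (differentiableAt_component_of_contDiffOn hB (Real.exp_pos _))
  refine ⟨fun h p => (key p).2 (h _ (Real.exp_pos _)), fun h p hp => ?_⟩
  simpa only [Real.exp_log hp] using (key (Real.log p.1, p.2)).1 (h _)
end

section
/- Let k ∈ ℝ³ be a nonzero vector and E₀ ∈ ℝ³ satisfy k·E₀ = 0. Define, for t > 0 and x ∈ ℝ³, the phase φ(t,x) := k·x + |k|·ln t, and the fields E(t,x) := E₀·cos(φ(t,x)) and B(t,x) := (1/|k|)·(k × E₀)·cos(φ(t,x)). Then E and B are smooth on t > 0 and satisfy the vacuum Carrollian Maxwell equations there: ∇·B = 0, ∇·E = 0, ∇×E = t ∂_t B, and ∇×B = −t ∂_t E. In particular, Carrollian electromagnetism admits freely propagating plane-wave solutions with temporal parameter u = ln t. -/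
/-- Euclidean dot product on `ℝ³`. -/
def dot3 (a b : Fin 3 → ℝ) : ℝ := ∑ i : Fin 3, a i * b i

/-- Cross product on `ℝ³`. -/
def cross3 (a b : Fin 3 → ℝ) : Fin 3 → ℝ :=
  ![a 1 * b 2 - a 2 * b 1, a 2 * b 0 - a 0 * b 2, a 0 * b 1 - a 1 * b 0]

/-- The phase `φ(t,x) = k·x + |k|·ln t` of a Carrollian plane wave. -/
noncomputable def planePhase (k : Fin 3 → ℝ) : ℝ × (Fin 3 → ℝ) → ℝ :=
  fun p => dot3 k p.2 + Real.sqrt (dot3 k k) * Real.log p.1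

theorem dot3_self_pos {k : Fin 3 → ℝ} (hk : k ≠ 0) : 0 < dot3 k k := by
  obtain ⟨i, hi⟩ := Function.ne_iff.mp hk
  exact Finset.sum_pos' (fun j _ => mul_self_nonneg (k j))
    ⟨i, Finset.mem_univ i, mul_self_pos.mpr hi⟩

theorem contDiffOn_planePhase (k : Fin 3 → ℝ) :
    ContDiffOn ℝ (⊤ : ℕ∞) (planePhase k) {p : ℝ × (Fin 3 → ℝ) | 0 < p.1} := by
  have hlog : ContDiffOn ℝ (⊤ : ℕ∞) (fun p : ℝ × (Fin 3 → ℝ) => Real.log p.1)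
      {p : ℝ × (Fin 3 → ℝ) | 0 < p.1} :=
    contDiff_fst.contDiffOn.log fun p hp => ne_of_gt hp
  have hdot : ContDiff ℝ (⊤ : ℕ∞) (fun p : ℝ × (Fin 3 → ℝ) => dot3 k p.2) := by
    unfold dot3
    fun_prop
  exact hdot.contDiffOn.add (contDiffOn_const.mul hlog)

theorem contDiffOn_const_mul_cos_planePhase (k a : Fin 3 → ℝ) :
    ContDiffOn ℝ (⊤ : ℕ∞)
      (fun p : ℝ × (Fin 3 → ℝ) => fun i => a i * Real.cos (planePhase k p))
      {p : ℝ × (Fin 3 → ℝ) | 0 < p.1} :=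
  contDiffOn_pi.mpr fun _ => contDiffOn_const.mul (contDiffOn_planePhase k).cos

theorem pdS_const_mul_cos_planePhase (k : Fin 3 → ℝ) (c : ℝ) (j : Fin 3)
    (p : ℝ × (Fin 3 → ℝ)) :
    pdS j (fun q => c * Real.cos (planePhase k q)) p =
      -(c * k j * Real.sin (planePhase k p)) := by
  have hdot : HasDerivAt (fun s => dot3 k (Function.update p.2 j s)) (k j) (p.2 j) := by
    have h := HasDerivAt.fun_sum (u := Finset.univ) fun (i : Fin 3) _ =>
      ((hasDerivAt_pi.mp (hasDerivAt_update p.2 j (p.2 j))) i).const_mul (k i)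
    simpa [dot3, Pi.single_apply] using h
  have h := ((hdot.add_const (Real.sqrt (dot3 k k) * Real.log p.1)).cos).const_mul c
  have hd := h.deriv
  rw [Function.update_eq_self] at hd
  refine hd.trans ?_
  unfold planePhase
  ring

theorem mul_pdT_const_mul_cos_planePhase (k : Fin 3 → ℝ) (c : ℝ)
    {p : ℝ × (Fin 3 → ℝ)} (hp : 0 < p.1) :
    p.1 * pdT (fun q => c * Real.cos (planePhase k q)) p =
      -(c * Real.sqrt (dot3 k k) * Real.sin (planePhase k p)) := by
  have h := ((((Real.hasDerivAt_log hp.ne').const_mul (Real.sqrt (dot3 k k))).const_add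
    (dot3 k p.2)).cos).const_mul c
  have hd : pdT (fun q => c * Real.cos (planePhase k q)) p = _ := h.deriv
  rw [hd]
  unfold planePhase
  field_simp

theorem divg_mul_cos_planePhase (k a : Fin 3 → ℝ) (p : ℝ × (Fin 3 → ℝ)) :
    divg (fun q => fun i => a i * Real.cos (planePhase k q)) p =
      -(dot3 k a * Real.sin (planePhase k p)) := by
  simp only [divg, pdS_const_mul_cos_planePhase, dot3, Fin.sum_univ_three]
  ring

theorem curl_mul_cos_planePhase (k a : Fin 3 → ℝ) (p : ℝ × (Fin 3 → ℝ)) (i : Fin 3) :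
    curl (fun q => fun i => a i * Real.cos (planePhase k q)) p i =
      -(cross3 k a i * Real.sin (planePhase k p)) := by
  fin_cases i <;> simp [curl, pdS_const_mul_cos_planePhase, cross3] <;> ring

theorem dot3_const_mul_cross3_self (k a : Fin 3 → ℝ) (c : ℝ) :
    dot3 k (fun i => c * cross3 k a i) = 0 := by
  simp [dot3, cross3, Fin.sum_univ_three]
  ring

theorem cross3_const_mul_cross3_of_dot3_eq_zero {k a : Fin 3 → ℝ} (h : dot3 k a = 0) (c : ℝ)
    (i : Fin 3) : cross3 k (fun j => c * cross3 k a j) i = -(c * dot3 k k * a i) := by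
  have h' : k 0 * a 0 + k 1 * a 1 + k 2 * a 2 = 0 := by
    simpa [dot3, Fin.sum_univ_three] using h
  fin_cases i <;> simp [dot3, cross3, Fin.sum_univ_three]
  · linear_combination c * k 0 * h'
  · linear_combination c * k 1 * h'
  · linear_combination c * k 2 * h'

/-- Carrollian electromagnetism admits freely propagating plane-wave solutions with
temporal parameter `u = ln t`: for a nonzero wave vector `k` and amplitude `E₀ ⊥ k`,
the fields `E = E₀ cos(k·x + |k| ln t)` and `B = |k|⁻¹ (k × E₀) cos(k·x + |k| ln t)`
are smooth on `t > 0` and solve the vacuum Carrollian Maxwell equations there. -/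
theorem carrollMaxwell_plane_wave (k E₀ : Fin 3 → ℝ) (hk : k ≠ 0)
    (hperp : dot3 k E₀ = 0) :
    ContDiffOn ℝ (⊤ : ℕ∞)
      (fun p : ℝ × (Fin 3 → ℝ) => fun i => E₀ i * Real.cos (planePhase k p))
      {p : ℝ × (Fin 3 → ℝ) | 0 < p.1} ∧
    ContDiffOn ℝ (⊤ : ℕ∞)
      (fun p : ℝ × (Fin 3 → ℝ) => fun i =>
        (Real.sqrt (dot3 k k))⁻¹ * cross3 k E₀ i * Real.cos (planePhase k p))
      {p : ℝ × (Fin 3 → ℝ) | 0 < p.1} ∧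
    ∀ p : ℝ × (Fin 3 → ℝ), 0 < p.1 →
      IsCarrollMaxwellAt
        (fun q => fun i => E₀ i * Real.cos (planePhase k q))
        (fun q => fun i =>
          (Real.sqrt (dot3 k k))⁻¹ * cross3 k E₀ i * Real.cos (planePhase k q))
        p := by
  have hpos := dot3_self_pos hk
  have hsqrt : Real.sqrt (dot3 k k) ≠ 0 := (Real.sqrt_pos.mpr hpos).ne'
  refine ⟨contDiffOn_const_mul_cos_planePhase k E₀,
    contDiffOn_const_mul_cos_planePhase k _, fun p hp => ⟨?_, ?_, fun i => ?_, fun i => ?_⟩⟩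
  · rw [divg_mul_cos_planePhase k (fun i => (Real.sqrt (dot3 k k))⁻¹ * cross3 k E₀ i),
      dot3_const_mul_cross3_self, zero_mul, neg_zero]
  · rw [divg_mul_cos_planePhase, hperp, zero_mul, neg_zero]
  · rw [curl_mul_cos_planePhase, mul_pdT_const_mul_cos_planePhase k _ hp]
    field_simp
  · rw [curl_mul_cos_planePhase k (fun i => (Real.sqrt (dot3 k k))⁻¹ * cross3 k E₀ i),
      mul_pdT_const_mul_cos_planePhase k _ hp, cross3_const_mul_cross3_of_dot3_eq_zero hperp]
    have hinv : (Real.sqrt (dot3 k k))⁻¹ * dot3 k k = Real.sqrt (dot3 k k) := by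
      rw [inv_mul_eq_iff_eq_mul₀ hsqrt, Real.mul_self_sqrt hpos.le]
    rw [hinv]
    ring
end
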